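/- Main theorem (utility–leakage guarantees under LDP): let U, S, X be random variables on finite sets with joint distribution p_{USX}, let Q be any Markov kernel from 𝒳 to a finite set 𝒵̂ (the encoder), and let M be a Markov kernel from 𝒵̂ to a finite set 𝒵 satisfying ε-LDP (the randomizer). Let Z be generated by the composed kernel K(z|x) = Σ_{ẑ} M(z|ẑ) Q(ẑ|x), so that (U, S) → X → Z forms a Markov chain. Suppose I(X; Z | S) = ν and I(U; Z) ≥ γ. Then: (i) K satisfies ε-LDP; (ii) the utility Γ = I(U; Z) satisfies γ ≤ Γ ≤ ε; and (iii) the sensitive information leakage Ω = I(S; Z) satisfies Ω ≤ ε − ν. -/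

import Mathlib

open Finset

noncomputable section

/-- A Markov kernel between finite types: each row is a probability mass function. -/
def IsMarkovKernel' {A B : Type*} [Fintype B] (K : A → B → ℝ) : Prop :=
  (∀ a b, 0 ≤ K a b) ∧ ∀ a, ∑ b, K a b = 1

/-- ε-local differential privacy for a kernel. -/
def IsLDP {A B : Type*} (ε : ℝ) (K : A → B → ℝ) : Prop :=
  ∀ a a' b, K a b ≤ Real.exp ε * K a' b

/-- The composed kernel `K(z|x) = Σ_{ẑ} M(z|ẑ) Q(ẑ|x)`. -/
def composedKernel {X Zh Z : Type*} [Fintype Zh]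
    (Q : X → Zh → ℝ) (M : Zh → Z → ℝ) (x : X) (z : Z) : ℝ :=
  ∑ zh, M zh z * Q x zh

/-- The joint distribution of `(U, S, X, Z)` induced by the source `p_{USX}` and the
composed kernel, so that `(U, S) → X → Z` is a Markov chain. -/
def jointUSXZ {U S X Zh Z : Type*} [Fintype Zh]
    (pUSX : U → S → X → ℝ) (Q : X → Zh → ℝ) (M : Zh → Z → ℝ)
    (u : U) (s : S) (x : X) (z : Z) : ℝ :=
  pUSX u s x * composedKernel Q M x z

variable {U S X Z : Type*} [Fintype U] [Fintype S] [Fintype X] [Fintype Z]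

/-- Marginal of `U`. -/
def margU (q : U → S → X → Z → ℝ) (u : U) : ℝ := ∑ s, ∑ x, ∑ z, q u s x z

/-- Marginal of `S`. -/
def margS (q : U → S → X → Z → ℝ) (s : S) : ℝ := ∑ u, ∑ x, ∑ z, q u s x z

/-- Marginal of `Z`. -/
def margZ (q : U → S → X → Z → ℝ) (z : Z) : ℝ := ∑ u, ∑ s, ∑ x, q u s x z

/-- Marginal of `(U, Z)`. -/
def margUZ (q : U → S → X → Z → ℝ) (u : U) (z : Z) : ℝ := ∑ s, ∑ x, q u s x z

/-- Marginal of `(S, Z)`. -/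
def margSZ (q : U → S → X → Z → ℝ) (s : S) (z : Z) : ℝ := ∑ u, ∑ x, q u s x z

/-- Marginal of `(S, X)`. -/
def margSX (q : U → S → X → Z → ℝ) (s : S) (x : X) : ℝ := ∑ u, ∑ z, q u s x z

/-- Marginal of `(S, X, Z)`. -/
def margSXZ (q : U → S → X → Z → ℝ) (s : S) (x : X) (z : Z) : ℝ := ∑ u, q u s x z

/-- Mutual information `I(U;Z)` in nats (zero-probability terms vanish). -/
def miUZ (q : U → S → X → Z → ℝ) : ℝ :=
  ∑ u, ∑ z, margUZ q u z * Real.log (margUZ q u z / (margU q u * margZ q z))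

/-- Mutual information `I(S;Z)` in nats (zero-probability terms vanish). -/
def miSZ (q : U → S → X → Z → ℝ) : ℝ :=
  ∑ s, ∑ z, margSZ q s z * Real.log (margSZ q s z / (margS q s * margZ q z))

/-- Conditional mutual information `I(X;Z∣S)` in nats (zero-probability terms vanish,
and division by zero is zero by convention). -/
def cmiXZgivenS (q : U → S → X → Z → ℝ) : ℝ :=
  ∑ s, margS q s * ∑ x, ∑ z,
    (margSXZ q s x z / margS q s) *
      Real.log ((margSXZ q s x z / margS q s) /
        ((margSX q s x / margS q s) * (margSZ q s z / margS q s)))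

/-- The composition of two Markov kernels is a Markov kernel. -/
theorem IsMarkovKernel'.composedKernel {A B C : Type*} [Fintype B] [Fintype C]
    {Q : A → B → ℝ} {M : B → C → ℝ} (hM : IsMarkovKernel' M) (hQ : IsMarkovKernel' Q) :
    IsMarkovKernel' (composedKernel Q M) := by
  refine ⟨fun a c => sum_nonneg fun b _ => mul_nonneg (hM.1 b c) (hQ.1 a b), fun a => ?_⟩
  simp only [_root_.composedKernel]
  rw [sum_comm]
  simp [← sum_mul, hM.2, hQ.2]

/-- Local differential privacy is preserved by pre-processing with a Markov kernel. -/
theorem IsLDP.composedKernel {A B C : Type*} [Fintype B] {ε : ℝ}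
    {Q : A → B → ℝ} {M : B → C → ℝ} (hM : IsLDP ε M) (hQ : IsMarkovKernel' Q) :
    IsLDP ε (composedKernel Q M) := by
  intro a a' c
  have average_le : ∀ b, M b c ≤ Real.exp ε * ∑ b', M b' c * Q a' b' := fun b =>
    calc M b c = ∑ b', M b c * Q a' b' := by rw [← mul_sum, hQ.2, mul_one]
      _ ≤ ∑ b', Real.exp ε * (M b' c * Q a' b') := sum_le_sum fun b' _ => by
          rw [← mul_assoc]
          exact mul_le_mul_of_nonneg_right (hM b b' c) (hQ.1 a' b')
      _ = _ := (mul_sum _ _ _).symm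
  calc ∑ b, M b c * Q a b
      ≤ ∑ b, (Real.exp ε * ∑ b', M b' c * Q a' b') * Q a b := sum_le_sum fun b _ =>
        mul_le_mul_of_nonneg_right (average_le b) (hQ.1 a b)
    _ = _ := by rw [← mul_sum, hQ.2, mul_one]; rfl

theorem mul_log_div_le {a b ε : ℝ} (ha : 0 ≤ a) (hab : a ≤ Real.exp ε * b) :
    a * Real.log (a / b) ≤ a * ε := by
  rcases ha.eq_or_lt with rfl | ha'
  · simp
  have hb : 0 < b := pos_of_mul_pos_right (ha'.trans_le hab) (Real.exp_pos ε).le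
  refine mul_le_mul_of_nonneg_left ?_ ha
  rw [Real.log_le_iff_le_exp (div_pos ha' hb)]
  exact (div_le_iff₀ hb).2 hab

/-- A pointwise bound on the information density bounds `I(U;Z)`. -/
theorem miUZ_le {q : U → S → X → Z → ℝ} {ε : ℝ} (hq : ∀ u s x z, 0 ≤ q u s x z)
    (hq_sum : ∑ u, ∑ s, ∑ x, ∑ z, q u s x z = 1)
    (hle : ∀ u s x z, q u s x z ≤ Real.exp ε * ((∑ z', q u s x z') * margZ q z)) :
    miUZ q ≤ ε := by
  have total : ∑ u, ∑ z, margUZ q u z = 1 := by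
    rw [← hq_sum]
    refine sum_congr rfl fun u _ => ?_
    simp only [margUZ]
    rw [sum_comm]
    exact sum_congr rfl fun s _ => sum_comm
  have bound : ∀ u z, margUZ q u z ≤ Real.exp ε * (margU q u * margZ q z) := fun u z => by
    simp only [margUZ, margU, sum_mul, mul_sum (s := univ) (a := Real.exp ε)]
    refine sum_le_sum fun s _ => sum_le_sum fun x _ => (hle u s x z).trans_eq ?_
    rw [sum_mul, mul_sum]
  calc miUZ q ≤ ∑ u, ∑ z, margUZ q u z * ε := sum_le_sum fun u _ => sum_le_sum fun z _ =>
        mul_log_div_le (sum_nonneg fun s _ => sum_nonneg fun x _ => hq u s x z) (bound u z)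
    _ = ε := by simp only [← sum_mul, total, one_mul]

/-- The chain rule `I(S;Z) + I(X;Z∣S) = I(S,X;Z)`. -/
theorem miSZ_add_cmiXZgivenS {q : U → S → X → Z → ℝ} (hq : ∀ u s x z, 0 ≤ q u s x z) :
    miSZ q + cmiXZgivenS q = ∑ s, ∑ x, ∑ z,
      margSXZ q s x z * Real.log (margSXZ q s x z / (margSX q s x * margZ q z)) := by
  have margSZ_eq : ∀ s z, margSZ q s z = ∑ x, margSXZ q s x z := fun s z => sum_comm
  have margSX_eq : ∀ s x, margSX q s x = ∑ z, margSXZ q s x z := fun s x => sum_comm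
  have margS_eq : ∀ s, margS q s = ∑ x, margSX q s x := fun s => sum_comm
  have margZ_eq : ∀ z, margZ q z = ∑ s, margSZ q s z := fun z => sum_comm
  have hSXZ : ∀ s x z, 0 ≤ margSXZ q s x z := fun s x z => sum_nonneg fun u _ => hq u s x z
  have hSX : ∀ s x, 0 ≤ margSX q s x := fun s x => by
    rw [margSX_eq]; exact sum_nonneg fun z _ => hSXZ s x z
  have hSZ : ∀ s z, 0 ≤ margSZ q s z := fun s z => by
    rw [margSZ_eq]; exact sum_nonneg fun x _ => hSXZ s x z
  have miSZ_eq : miSZ q = ∑ s, ∑ x, ∑ z,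
      margSXZ q s x z * Real.log (margSZ q s z / (margS q s * margZ q z)) := by
    refine sum_congr rfl fun s _ => ?_
    rw [sum_comm]
    refine sum_congr rfl fun z _ => ?_
    rw [← sum_mul, ← margSZ_eq]
  rw [miSZ_eq, cmiXZgivenS]
  simp only [mul_sum, ← sum_add_distrib]
  refine sum_congr rfl fun s _ => sum_congr rfl fun x _ => sum_congr rfl fun z _ => ?_
  rcases (hSXZ s x z).eq_or_lt with h | h
  · simp [← h]
  have hSX' : 0 < margSX q s x := h.trans_le <| by
    rw [margSX_eq]; exact single_le_sum (fun z _ => hSXZ s x z) (mem_univ z)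
  have hSZ' : 0 < margSZ q s z := h.trans_le <| by
    rw [margSZ_eq]
    exact single_le_sum (f := fun x => margSXZ q s x z) (fun x _ => hSXZ s x z) (mem_univ x)
  have hS' : 0 < margS q s := hSX'.trans_le <| by
    rw [margS_eq]; exact single_le_sum (fun x _ => hSX s x) (mem_univ x)
  have hZ' : 0 < margZ q z := hSZ'.trans_le <| by
    rw [margZ_eq]
    exact single_le_sum (f := fun s => margSZ q s z) (fun s _ => hSZ s z) (mem_univ s)
  rw [← mul_assoc, mul_div_cancel₀ _ hS'.ne', ← mul_add, ← Real.log_mul (by positivity)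
    (by positivity)]
  congr 2
  field_simp

/-- A pointwise bound on the information density bounds `I(S;Z) + I(X;Z∣S)`. -/
theorem miSZ_add_cmiXZgivenS_le {q : U → S → X → Z → ℝ} {ε : ℝ}
    (hq : ∀ u s x z, 0 ≤ q u s x z) (hq_sum : ∑ u, ∑ s, ∑ x, ∑ z, q u s x z = 1)
    (hle : ∀ u s x z, q u s x z ≤ Real.exp ε * ((∑ z', q u s x z') * margZ q z)) :
    miSZ q + cmiXZgivenS q ≤ ε := by
  have total : ∑ s, ∑ x, ∑ z, margSXZ q s x z = 1 := by
    rw [← hq_sum, sum_comm (s := (univ : Finset U))]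
    refine sum_congr rfl fun s _ => ?_
    rw [sum_comm (s := (univ : Finset U))]
    exact sum_congr rfl fun x _ => sum_comm
  have bound : ∀ s x z, margSXZ q s x z ≤ Real.exp ε * (margSX q s x * margZ q z) :=
    fun s x z => by
      simp only [margSXZ, margSX]
      rw [sum_mul, mul_sum]
      exact sum_le_sum fun u _ => hle u s x z
  calc miSZ q + cmiXZgivenS q
      ≤ ∑ s, ∑ x, ∑ z, margSXZ q s x z * ε := by
        rw [miSZ_add_cmiXZgivenS hq]
        exact sum_le_sum fun s _ => sum_le_sum fun x _ => sum_le_sum fun z _ =>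
          mul_log_div_le (sum_nonneg fun u _ => hq u s x z) (bound s x z)
    _ = ε := by simp only [← sum_mul, total, one_mul]

/-- Main theorem (utility–leakage guarantees under LDP): with an encoder `Q`, an ε-LDP
randomizer `M`, and `Z` generated by the composed kernel, if `I(X;Z∣S) = ν` and
`I(U;Z) ≥ γ`, then (i) the composed kernel is ε-LDP, (ii) the utility `Γ = I(U;Z)`
satisfies `γ ≤ Γ ≤ ε`, and (iii) the leakage `Ω = I(S;Z)` satisfies `Ω ≤ ε − ν`. -/
theorem utility_leakage_guarantees
    {Zh : Type*} [Fintype Zh]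
    [Nonempty U] [Nonempty S] [Nonempty X] [Nonempty Zh] [Nonempty Z]
    (ε γ ν : ℝ) (hε : 0 ≤ ε)
    (pUSX : U → S → X → ℝ)
    (hp0 : ∀ u s x, 0 ≤ pUSX u s x) (hp1 : ∑ u, ∑ s, ∑ x, pUSX u s x = 1)
    (Q : X → Zh → ℝ) (hQ : IsMarkovKernel' Q)
    (M : Zh → Z → ℝ) (hM : IsMarkovKernel' M) (hMldp : IsLDP ε M)
    (hν : cmiXZgivenS (jointUSXZ pUSX Q M) = ν)
    (hγ : γ ≤ miUZ (jointUSXZ pUSX Q M)) :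
    IsLDP ε (composedKernel Q M) ∧
      (γ ≤ miUZ (jointUSXZ pUSX Q M) ∧ miUZ (jointUSXZ pUSX Q M) ≤ ε) ∧
      miSZ (jointUSXZ pUSX Q M) ≤ ε - ν := by
  have hK := hM.composedKernel hQ
  have hldp := hMldp.composedKernel hQ
  have hq : ∀ u s x z, 0 ≤ jointUSXZ pUSX Q M u s x z := fun u s x z =>
    mul_nonneg (hp0 u s x) (hK.1 x z)
  have hq_row : ∀ u s x, ∑ z, jointUSXZ pUSX Q M u s x z = pUSX u s x := fun u s x => by
    simp only [jointUSXZ]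
    rw [← mul_sum, hK.2, mul_one]
  have hq_sum : ∑ u, ∑ s, ∑ x, ∑ z, jointUSXZ pUSX Q M u s x z = 1 := by
    simpa only [hq_row] using hp1
  have kernel_le : ∀ x z,
      composedKernel Q M x z ≤ Real.exp ε * margZ (jointUSXZ pUSX Q M) z := fun x z =>
    calc composedKernel Q M x z
        = ∑ u, ∑ s, ∑ x', pUSX u s x' * composedKernel Q M x z := by
          simp only [← sum_mul, hp1, one_mul]
      _ ≤ ∑ u, ∑ s, ∑ x', Real.exp ε * jointUSXZ pUSX Q M u s x' z :=
          sum_le_sum fun u _ => sum_le_sum fun s _ => sum_le_sum fun x' _ =>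
            (mul_le_mul_of_nonneg_left (hldp x x' z) (hp0 u s x')).trans_eq
              (mul_left_comm _ _ _)
      _ = _ := by simp only [← mul_sum, margZ]
  have hle : ∀ u s x z, jointUSXZ pUSX Q M u s x z ≤
      Real.exp ε * ((∑ z', jointUSXZ pUSX Q M u s x z') * margZ (jointUSXZ pUSX Q M) z) :=
    fun u s x z => by
      rw [hq_row, mul_left_comm]
      exact mul_le_mul_of_nonneg_left (kernel_le x z) (hp0 u s x)
  exact ⟨hldp, ⟨hγ, miUZ_le hq hq_sum hle⟩,
    hν ▸ le_sub_iff_add_le.2 (miSZ_add_cmiXZgivenS_le hq hq_sum hle)⟩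

end
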